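/- Let F be a field of characteristic different from two, let q be an anisotropic form over F, and let K = F(√a) be a quadratic extension of F (a ∈ F× not a square). Then: (i) q_K is isotropic if and only if q ≅ b⟨1,−a⟩ ⊥ q′ for some form q′ over F and some b ∈ F×; (ii) q_K is hyperbolic if and only if q ≅ ⟨1,−a⟩ ⊗ p for some form p over F. -/

import Mathlib

set_option synthInstance.maxHeartbeats 1000000
set_option maxHeartbeats 4000000

open scoped BigOperators Classical

namespace QF

section Defs

variable {R : Type*} [CommRing R]

/-- Evaluation of the diagonal quadratic form with coefficients `d` at the vector `v`. -/
def evalQF {n : ℕ} (d : Fin n → R) (v : Fin n → R) : R := ∑ i, d i * v i ^ 2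

/-- A form is isotropic if it represents zero non-trivially. -/
def Isotropic {n : ℕ} (d : Fin n → R) : Prop := ∃ v : Fin n → R, v ≠ 0 ∧ evalQF d v = 0

def Anisotropic {n : ℕ} (d : Fin n → R) : Prop := ¬ Isotropic d

/-- Nondegeneracy of a diagonal form: all coefficients are nonzero. -/
def Nondeg {n : ℕ} (d : Fin n → R) : Prop := ∀ i, d i ≠ 0

/-- Two diagonal forms are isometric if a linear equivalence matches their values. -/
def Isometric {m n : ℕ} (d : Fin m → R) (e : Fin n → R) : Prop :=
  ∃ φ : (Fin m → R) ≃ₗ[R] (Fin n → R), ∀ v, evalQF e (φ v) = evalQF d v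

/-- Orthogonal sum of diagonal forms. -/
def osum {m n : ℕ} (d : Fin m → R) (e : Fin n → R) : Fin (m + n) → R := Fin.append d e

/-- Tensor product of diagonal forms. -/
def tensorQF {m n : ℕ} (d : Fin m → R) (e : Fin n → R) : Fin (m * n) → R :=
  fun i => d (finProdFinEquiv.symm i).1 * e (finProdFinEquiv.symm i).2

/-- Scaling of a form by a scalar. -/
def smulQF {n : ℕ} (a : R) (d : Fin n → R) : Fin n → R := fun i => a * d i

/-- `k` copies of the hyperbolic plane `⟨1,-1⟩`. -/
def hypform {R : Type*} [CommRing R] (k : ℕ) : Fin (k + k) → R :=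
  Fin.append (fun _ => 1) (fun _ => -1)

/-- A form is hyperbolic if it is isometric to a sum of hyperbolic planes,
i.e. its Witt index is half its dimension. -/
def IsHyperbolic {n : ℕ} (d : Fin n → R) : Prop := ∃ k : ℕ, Isometric d (hypform k)

/-- The Witt index: the largest `k` such that `d ≅ k×⟨1,-1⟩ ⊥ r`. -/
noncomputable def WittIndex {n : ℕ} (d : Fin n → R) : ℕ :=
  sSup {k : ℕ | ∃ (m : ℕ) (r : Fin m → R), Isometric d (osum (hypform k) r)}

/-- `r` is a subform of `d`: `d ≅ r ⊥ s` for some (nondegenerate) form `s`. -/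
def Subform {m n : ℕ} (r : Fin m → R) (d : Fin n → R) : Prop :=
  ∃ (k : ℕ) (s : Fin k → R), Nondeg s ∧ Isometric d (osum r s)

/-- The set of nonzero represented values. -/
def Dset {n : ℕ} (d : Fin n → R) : Set R :=
  {a | a ≠ 0 ∧ ∃ v : Fin n → R, evalQF d v = a}

/-- The group of similarity factors `G(q) = {a : a·q ≅ q}`. -/
def Gset {n : ℕ} (d : Fin n → R) : Set R :=
  {a | a ≠ 0 ∧ Isometric (smulQF a d) d}

/-- `H(q) = {a : ⟨1,-a⟩ ⊗ q is isotropic}`. -/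
def Hset {n : ℕ} (d : Fin n → R) : Set R :=
  {a | a ≠ 0 ∧ Isotropic (tensorQF ![1, -a] d)}

/-- Base change of a form along a ring homomorphism (e.g. a field extension). -/
def bc {S : Type*} [CommRing S] (f : R →+* S) {n : ℕ} (d : Fin n → R) : Fin n → S :=
  fun i => f (d i)

/-- The Pfister form `⟨1,a 0⟩ ⊗ ⋯ ⊗ ⟨1, a (n-1)⟩`: its `2^n` diagonal coefficients are
the products `∏_{j ∈ S} a j` over subsets `S` of the index set. -/
noncomputable def pfisterOf {n : ℕ} (a : Fin n → R) : Fin (2 ^ n) → R :=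
  fun i => ∏ j : Fin n, if (finFunctionFinEquiv.symm i) j = 0 then 1 else a j

/-- `π` is an `n`-fold Pfister form. -/
def IsNPfister (n : ℕ) {m : ℕ} (π : Fin m → R) : Prop :=
  ∃ a : Fin n → R, (∀ i, a i ≠ 0) ∧ Isometric π (pfisterOf a)

/-- `π` is a Pfister form. -/
def IsPfister {m : ℕ} (π : Fin m → R) : Prop := ∃ n : ℕ, IsNPfister n π

end Defs

/-- The quadric polynomial `p(X₁,…,Xₙ) = ∑ dᵢ Xᵢ²` attached to a diagonal form. -/
noncomputable def formPoly {F : Type*} [CommRing F] {n : ℕ} (d : Fin n → F) :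
    MvPolynomial (Fin n) F :=
  ∑ i, MvPolynomial.C (d i) * MvPolynomial.X i ^ 2

/-- The affine coordinate ring `F[X₁,…,Xₙ]/(p(X))` of the quadric `p = 0`. -/
abbrev CoordRing {F : Type*} [CommRing F] {n : ℕ} (d : Fin n → F) : Type _ :=
  MvPolynomial (Fin n) F ⧸ Ideal.span {formPoly d}

/-- The function field `F(p)` of the quadric `p = 0`: the total fraction ring of the
coordinate ring (the quotient field when the coordinate ring is a domain, i.e. when `p` is
anisotropic of dimension at least 2). -/
abbrev FunField {F : Type*} [Field F] {n : ℕ} (d : Fin n → F) : Type _ :=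
  FractionRing (CoordRing d)

end QF


namespace QF

section BilinearForm

variable {R : Type*} [CommRing R] {n : ℕ}

/-- The symmetric bilinear form attached to a diagonal quadratic form. -/
def bilin (d : Fin n → R) : (Fin n → R) →ₗ[R] (Fin n → R) →ₗ[R] R :=
  LinearMap.mk₂ R (fun x y => ∑ i, d i * x i * y i)
    (fun x y z => by simp only [Pi.add_apply, ← Finset.sum_add_distrib]; congr; ext; ring)
    (fun c x y => by
      simp only [Pi.smul_apply, smul_eq_mul, Finset.mul_sum]; congr; ext; ring)
    (fun x y z => by simp only [Pi.add_apply, ← Finset.sum_add_distrib]; congr; ext; ring)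
    (fun c x y => by
      simp only [Pi.smul_apply, smul_eq_mul, Finset.mul_sum]; congr; ext; ring)

theorem bilin_apply (d x y : Fin n → R) : bilin d x y = ∑ i, d i * x i * y i := rfl

theorem bilin_self (d x : Fin n → R) : bilin d x x = evalQF d x := by
  simp only [bilin_apply, evalQF]; congr; ext; ring

theorem bilin_comm (d x y : Fin n → R) : bilin d x y = bilin d y x := by
  simp only [bilin_apply]; congr; ext; ring

theorem bilin_single (d : Fin n → R) (i j : Fin n) :
    bilin d (Pi.single i 1) (Pi.single j 1) = if i = j then d i else 0 := by
  simp [bilin_apply, Pi.single_apply]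
  split_ifs <;> simp_all

theorem evalQF_add (d x y : Fin n → R) :
    evalQF d (x + y) = evalQF d x + evalQF d y + 2 * bilin d x y := by
  simp only [← bilin_self, map_add, LinearMap.add_apply, bilin_comm d y x]; ring

theorem evalQF_smul (d x : Fin n → R) (c : R) : evalQF d (c • x) = c ^ 2 * evalQF d x := by
  simp only [← bilin_self, map_smul, LinearMap.smul_apply, smul_eq_mul]; ring

theorem bilin_bc {S : Type*} [CommRing S] (f : R →+* S) (d x y : Fin n → R) :
    bilin (bc f d) (f ∘ x) (f ∘ y) = f (bilin d x y) := by
  simp [bilin_apply, bc]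

theorem evalQF_bc {S : Type*} [CommRing S] (f : R →+* S) (d x : Fin n → R) :
    evalQF (bc f d) (f ∘ x) = f (evalQF d x) := by
  rw [← bilin_self, bilin_bc, bilin_self]

end BilinearForm

section Field

variable {F : Type*} [Field F] {m n : ℕ}

theorem bilin_isometry (h2 : (2 : F) ≠ 0) {d : Fin m → F} {e : Fin n → F}
    (φ : (Fin m → F) ≃ₗ[F] (Fin n → F)) (hφ : ∀ v, evalQF e (φ v) = evalQF d v)
    (x y : Fin m → F) : bilin e (φ x) (φ y) = bilin d x y := by
  have h := hφ (x + y)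
  rw [map_add, evalQF_add, evalQF_add, hφ, hφ] at h
  exact mul_left_cancel₀ h2 (add_left_cancel h)

theorem Isometric.eq_dim {d : Fin m → F} {e : Fin n → F} (h : Isometric d e) : m = n := by
  obtain ⟨φ, -⟩ := h
  simpa using φ.finrank_eq

theorem Isometric.exists_orthogonal (h2 : (2 : F) ≠ 0) {d : Fin m → F} {e : Fin n → F}
    (h : Isometric d e) :
    ∃ u : Fin n → Fin m → F, ∀ i j, bilin d (u i) (u j) = if i = j then e i else 0 := by
  obtain ⟨φ, hφ⟩ := h
  refine ⟨fun i => φ.symm (Pi.single i 1), fun i j => ?_⟩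
  rw [← bilin_isometry h2 φ hφ]
  simp [bilin_single]

theorem isometric_of_orthogonal {d : Fin m → F} {e : Fin n → F} (hmn : n = m) (he : Nondeg e)
    (u : Fin n → Fin m → F) (hu : ∀ i j, bilin d (u i) (u j) = if i = j then e i else 0) :
    Isometric d e := by
  have hli : LinearIndependent F u :=
    LinearMap.linearIndependent_of_isOrthoᵢ (B := bilin d)
      (LinearMap.isOrthoᵢ_def.2 fun i j hij => by rw [hu, if_neg hij])
      (fun i => by rw [hu, if_pos rfl]; exact he i)
  let b := basisOfLinearIndependentOfCardEqFinrank' u hli (by simpa using hmn)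
  refine ⟨b.equivFun, fun v => ?_⟩
  have hv : v = ∑ i, b.equivFun v i • u i := by
    conv_lhs => rw [← b.sum_equivFun v]
    simp [b]
  generalize b.equivFun v = c at hv
  subst hv
  rw [← bilin_self d]
  simp only [map_sum, map_smul, LinearMap.sum_apply, LinearMap.smul_apply, hu, smul_eq_mul,
    mul_ite, mul_zero, Finset.sum_ite_eq', Finset.mem_univ, if_true, evalQF]
  refine Finset.sum_congr rfl fun i _ => by ring

theorem exists_ne_zero_orthogonal {ι : Type*} [Fintype ι] (d : Fin n → F)
    (u : ι → Fin n → F) (h : Fintype.card ι < n) : ∃ z ≠ 0, ∀ i, bilin d (u i) z = 0 := by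
  have := LinearMap.ker_ne_bot_of_finrank_lt (f := LinearMap.pi fun i => bilin d (u i))
    (by simpa using h)
  obtain ⟨z, hz, hz0⟩ := (Submodule.ne_bot_iff _).1 this
  exact ⟨z, hz0, fun i => congrFun hz i⟩

theorem Anisotropic.evalQF_ne_zero {d : Fin n → F} (hd : Anisotropic d) {x : Fin n → F}
    (hx : x ≠ 0) : evalQF d x ≠ 0 := fun h => hd ⟨x, hx, h⟩

theorem exists_orthogonal_extension {ι : Type*} [Fintype ι] (d : Fin n → F)
    (u : ι → Fin n → F) (k : ℕ) (h : Fintype.card ι + k ≤ n) :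
    ∃ w : Fin k → Fin n → F, (∀ j, w j ≠ 0) ∧ (∀ i j, bilin d (u i) (w j) = 0) ∧
      ∀ i j, i ≠ j → bilin d (w i) (w j) = 0 := by
  induction k with
  | zero => exact ⟨0, fun j => j.elim0, fun _ j => j.elim0, fun j => j.elim0⟩
  | succ k ih =>
    obtain ⟨w, hw0, huw, hww⟩ := ih (by omega)
    obtain ⟨z, hz0, hz⟩ := exists_ne_zero_orthogonal d (Sum.elim u w)
      (by simp only [Fintype.card_sum, Fintype.card_fin]; omega)
    have hwz : ∀ j, bilin d (w j) z = 0 := fun j => hz (Sum.inr j)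
    refine ⟨Fin.cons z w, fun j => ?_, fun i j => ?_, fun i j => ?_⟩
    · cases j using Fin.cases <;> simp [hz0, hw0]
    · cases j using Fin.cases
      · simpa using hz (Sum.inl i)
      · simp [huw]
    · cases i using Fin.cases <;> cases j using Fin.cases
      · simp
      · simp [bilin_comm d z, hwz]
      · simp [hwz]
      · simpa using hww _ _

theorem isometric_osum_of_orthogonal {d : Fin n → F} (hd : Anisotropic d) {e : Fin m → F}
    (he : Nondeg e) (u : Fin m → Fin n → F)
    (hu : ∀ i j, bilin d (u i) (u j) = if i = j then e i else 0) :
    ∃ (k : ℕ) (e' : Fin k → F), Nondeg e' ∧ Isometric d (osum e e') := by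
  have hli : LinearIndependent F u :=
    LinearMap.linearIndependent_of_isOrthoᵢ (B := bilin d)
      (LinearMap.isOrthoᵢ_def.2 fun i j hij => by rw [hu, if_neg hij])
      (fun i => by rw [hu, if_pos rfl]; exact he i)
  have hmn : m ≤ n := by simpa using hli.fintype_card_le_finrank
  obtain ⟨w, hw0, huw, hww⟩ := exists_orthogonal_extension d u (n - m) (by simp; omega)
  have he' : Nondeg fun j => evalQF d (w j) := fun j => hd.evalQF_ne_zero (hw0 j)
  refine ⟨n - m, fun j => evalQF d (w j), he',
    isometric_of_orthogonal (by omega) ?_ (Fin.append u w) fun i j => ?_⟩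
  · intro i
    cases i using Fin.addCases <;> simp [osum, he _, he' _]
  · cases i using Fin.addCases <;> cases j using Fin.addCases
    · simp [osum, hu]
    · simp [osum, huw, Fin.ext_iff]; omega
    · simp [osum, bilin_comm d (w _) (u _), huw, Fin.ext_iff]; omega
    · rename_i i j
      by_cases hij : i = j
      · simp [osum, hij, bilin_self]
      · simp [hij, hww i j hij]

theorem exists_orthogonal_family_of_antiSelfAdjoint {d : Fin n → F}
    (T : (Fin n → F) →ₗ[F] (Fin n → F)) (hT : ∀ x y, bilin d (T x) y = - bilin d x (T y))
    (hTself : ∀ x, bilin d x (T x) = 0) (k : ℕ) (hk : 2 * k ≤ n) :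
    ∃ w : Fin k → Fin n → F, (∀ j, w j ≠ 0) ∧ (∀ i j, bilin d (w i) (T (w j)) = 0) ∧
      ∀ i j, i ≠ j → bilin d (w i) (w j) = 0 := by
  induction k with
  | zero => exact ⟨0, fun j => j.elim0, fun j => j.elim0, fun j => j.elim0⟩
  | succ k ih =>
    obtain ⟨w, hw0, hTw, hww⟩ := ih (by omega)
    obtain ⟨z, hz0, hz⟩ := exists_ne_zero_orthogonal d (Sum.elim w (T ∘ w))
      (by simp only [Fintype.card_sum, Fintype.card_fin]; omega)
    have hwz : ∀ j, bilin d (w j) z = 0 := fun j => hz (Sum.inl j)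
    have hTwz : ∀ j, bilin d (T (w j)) z = 0 := fun j => hz (Sum.inr j)
    refine ⟨Fin.cons z w, fun j => ?_, fun i j => ?_, fun i j => ?_⟩
    · cases j using Fin.cases <;> simp [hz0, hw0]
    · cases i using Fin.cases <;> cases j using Fin.cases
      · simp [hTself]
      · simp [bilin_comm d z, hTwz]
      · rename_i j
        have := hT (w j) z
        rw [hTwz, zero_eq_neg] at this
        simp [this]
      · simp [hTw]
    · cases i using Fin.cases <;> cases j using Fin.cases
      · simp
      · simp [bilin_comm d z, hwz]
      · simp [hwz]
      · simpa using hww _ _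

/-- A form with an anti-self-adjoint square root of `a` is a multiple of `⟨1, -a⟩`. -/
theorem isometric_tensorQF_of_sq_eq {d : Fin n → F} (hd : Anisotropic d) {a : F} (ha : a ≠ 0)
    (T : (Fin n → F) →ₗ[F] (Fin n → F))
    (hT2 : ∀ x, T (T x) = a • x) (hT : ∀ x y, bilin d (T x) y = - bilin d x (T y))
    (hTself : ∀ x, bilin d x (T x) = 0) {k : ℕ} (hk : 2 * k = n) :
    ∃ p : Fin k → F, Nondeg p ∧ Isometric d (tensorQF ![1, -a] p) := by
  obtain ⟨w, hw0, hTw, hww⟩ := exists_orthogonal_family_of_antiSelfAdjoint T hT hTself k hk.le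
  have hp : Nondeg fun j => evalQF d (w j) := fun j => hd.evalQF_ne_zero (hw0 j)
  have hw : ∀ i j, bilin d (w i) (w j) = if i = j then evalQF d (w i) else 0 := by
    intro i j
    split_ifs with hij
    · rw [hij, bilin_self]
    · exact hww i j hij
  refine ⟨fun j => evalQF d (w j), hp, isometric_of_orthogonal hk ?_
    (fun i => ![w (finProdFinEquiv.symm i).2, T (w (finProdFinEquiv.symm i).2)]
      (finProdFinEquiv.symm i).1) fun i j => ?_⟩
  · intro i
    refine mul_ne_zero ?_ (hp _)
    generalize (finProdFinEquiv.symm i).1 = r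
    fin_cases r <;> simp [ha]
  · have hij : i = j ↔ finProdFinEquiv.symm i = finProdFinEquiv.symm j :=
      finProdFinEquiv.symm.injective.eq_iff.symm
    simp only [tensorQF, hij]
    generalize finProdFinEquiv.symm i = x
    generalize finProdFinEquiv.symm j = y
    obtain ⟨r, i⟩ := x
    obtain ⟨t, j⟩ := y
    fin_cases r <;> fin_cases t
    · simp [hw]
    · simp [hTw]
    · simp [hTw, bilin_comm d (T _) (w _)]
    · by_cases h : i = j <;> simp [hT, hT2, hw, h]

theorem isHyperbolic_of_isometric_tensorQF (h2 : (2 : F) ≠ 0) {d : Fin n → F} {s : F}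
    (hs : s ≠ 0) {k : ℕ} {p : Fin k → F} (hp : Nondeg p)
    (h : Isometric d (tensorQF ![1, -(s * s)] p)) : IsHyperbolic d := by
  obtain ⟨u, hu⟩ := h.exists_orthogonal h2
  have hdim := h.eq_dim
  let E : Fin k → Fin n → F := fun j => u (finProdFinEquiv (0, j))
  let T : Fin k → Fin n → F := fun j => s⁻¹ • u (finProdFinEquiv (1, j))
  have hEE : ∀ i j, bilin d (E i) (E j) = if i = j then p i else 0 := by
    intro i j; simp only [E, hu, tensorQF]; simp
  have hET : ∀ i j, bilin d (E i) (T j) = 0 := by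
    intro i j; simp only [E, T, map_smul, hu]; simp
  have hTT : ∀ i j, bilin d (T i) (T j) = if i = j then - p i else 0 := by
    intro i j; simp only [T, map_smul, LinearMap.smul_apply, hu, tensorQF]
    by_cases hij : i = j
    · simp [hij]; field_simp
    · simp [hij]
  let g : F → Fin k → Fin n → F := fun ε j =>
    (2⁻¹ : F) • (E j + T j) + (ε / (2 * p j)) • (E j - T j)
  have hg : ∀ ε δ i j, bilin d (g ε i) (g δ j) = if i = j then (ε + δ) / 2 else 0 := by
    intro ε δ i j
    simp only [g, map_add, map_smul, map_sub, LinearMap.add_apply, LinearMap.smul_apply,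
      LinearMap.sub_apply, hEE, hET, hTT, bilin_comm d (T _) (E _), smul_eq_mul]
    by_cases hij : i = j
    · subst hij
      have := hp i
      simp
      field_simp
      ring
    · simp [hij]
  refine ⟨k, isometric_of_orthogonal (by omega) ?_ (Fin.append (g 1) (g (-1))) fun i j => ?_⟩
  · intro i
    cases i using Fin.addCases <;> simp [hypform, -Fin.natAdd_eq_addNat]
  · cases i using Fin.addCases <;> cases j using Fin.addCases
    · simp [hypform, hg]
      norm_num [h2]
    · simp [hypform, hg, Fin.ext_iff, -Fin.natAdd_eq_addNat]; omega
    · simp [hypform, hg, Fin.ext_iff, -Fin.natAdd_eq_addNat]; omega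
    · simp [hypform, hg, -Fin.natAdd_eq_addNat]
      congr 1
      field_simp
      norm_num

theorem Isometric.baseChange {K : Type*} [Field K] (h2 : (2 : F) ≠ 0) {d : Fin m → F} {e : Fin n → F}
    (he : Nondeg e) (h : Isometric d e) (f : F →+* K) : Isometric (bc f d) (bc f e) := by
  obtain ⟨u, hu⟩ := h.exists_orthogonal h2
  refine isometric_of_orthogonal h.eq_dim.symm (fun i => by simpa [bc] using he i)
    (fun i => f ∘ u i) fun i j => ?_
  rw [bilin_bc, hu]
  split_ifs <;> simp [bc]

end Field

section QuadraticExtension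

variable {F K : Type*} [Field F] [Field K] [Algebra F K] {n : ℕ}

theorem evalQF_bc_add_smul (q x y : Fin n → F) {a : F} {s : K} (hs : s * s = algebraMap F K a) :
    evalQF (bc (algebraMap F K) q) (algebraMap F K ∘ x + s • (algebraMap F K ∘ y)) =
      algebraMap F K (evalQF q x + a * evalQF q y) +
        s * algebraMap F K (2 * bilin q x y) := by
  rw [evalQF_add, evalQF_smul, map_smul, bilin_bc, evalQF_bc, evalQF_bc, sq, hs]
  simp only [map_add, map_mul, map_ofNat, smul_eq_mul]
  ring

variable {a : F} {s : K} (E : (F × F) ≃ₗ[F] K)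

/-- Coordinates of `Fin n → K` over `F` coming from coordinates of `K` over `F`. -/
def coords (n : ℕ) : ((Fin n → F) × (Fin n → F)) ≃ₗ[F] (Fin n → K) where
  toFun v i := E (v.1 i, v.2 i)
  map_add' v w := by ext i; simp [← map_add]
  map_smul' c v := by ext i; simp [← map_smul]
  invFun v := (fun i => (E.symm (v i)).1, fun i => (E.symm (v i)).2)
  left_inv v := by simp
  right_inv v := by simp

theorem coords_apply (hE : ∀ x y, E (x, y) = algebraMap F K x + s * algebraMap F K y)
    (x y : Fin n → F) :
    coords E n (x, y) = algebraMap F K ∘ x + s • (algebraMap F K ∘ y) := by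
  ext i; exact hE _ _

theorem evalQF_coords_eq_zero_iff (h2 : (2 : F) ≠ 0) (hs : s * s = algebraMap F K a)
    (hE : ∀ x y, E (x, y) = algebraMap F K x + s * algebraMap F K y) (q x y : Fin n → F) :
    evalQF (bc (algebraMap F K) q) (coords E n (x, y)) = 0 ↔
      evalQF q x = -(a * evalQF q y) ∧ bilin q x y = 0 := by
  rw [coords_apply E hE, evalQF_bc_add_smul q x y hs, ← hE, LinearEquiv.map_eq_zero_iff,
    Prod.mk_eq_zero, add_eq_zero_iff_eq_neg, mul_eq_zero, or_iff_right h2]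

theorem isotropic_bc_iff (h2 : (2 : F) ≠ 0) (hs : s * s = algebraMap F K a)
    (hE : ∀ x y, E (x, y) = algebraMap F K x + s * algebraMap F K y) (ha : a ≠ 0)
    {q : Fin n → F} (hq : Anisotropic q) :
    Isotropic (bc (algebraMap F K) q) ↔ ∃ b : F, b ≠ 0 ∧ ∃ (k : ℕ) (q' : Fin k → F),
      Nondeg q' ∧ Isometric q (osum (smulQF b ![1, -a]) q') := by
  constructor
  · rintro ⟨v, hv0, hv⟩
    obtain ⟨⟨x, y⟩, rfl⟩ := (coords E n).surjective v
    rw [evalQF_coords_eq_zero_iff E h2 hs hE] at hv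
    obtain ⟨hxy, hB⟩ := hv
    have hy : y ≠ 0 := by
      rintro rfl
      have hx : x ≠ 0 := by
        rintro rfl
        exact hv0 (map_zero (coords E n))
      exact hq.evalQF_ne_zero hx (by simpa [evalQF] using hxy)
    have hb := hq.evalQF_ne_zero hy
    refine ⟨evalQF q y, hb, isometric_osum_of_orthogonal hq ?_ ![y, x] ?_⟩
    · intro i
      fin_cases i <;> simp [smulQF, hb, ha]
    · intro i j
      fin_cases i <;> fin_cases j
      · simp [smulQF, bilin_self]
      · simp [bilin_comm q y, hB]
      · simp [hB]
      · simp [smulQF, bilin_self, hxy, mul_comm]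
  · rintro ⟨b, hb, k, q', -, h⟩
    obtain ⟨u, hu⟩ := h.exists_orthogonal h2
    have h0 : evalQF q (u (Fin.castAdd k 0)) = b := by
      rw [← bilin_self, hu, if_pos rfl, osum, Fin.append_left]; simp [smulQF]
    have h1 : evalQF q (u (Fin.castAdd k 1)) = b * -a := by
      rw [← bilin_self, hu, if_pos rfl, osum, Fin.append_left]; simp [smulQF]
    refine ⟨coords E n (u (Fin.castAdd k 1), u (Fin.castAdd k 0)), fun h => ?_,
      (evalQF_coords_eq_zero_iff E h2 hs hE _ _ _).2 ⟨by rw [h0, h1]; ring, ?_⟩⟩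
    · rw [LinearEquiv.map_eq_zero_iff, Prod.mk_eq_zero] at h
      rw [h.2] at h0
      exact hb (by simpa [evalQF] using h0.symm)
    · rw [hu, if_neg (by simp [Fin.ext_iff])]

include E in
theorem finrank_pi_of_coords (k : ℕ) : Module.finrank F (Fin k → K) = 2 * k := by
  rw [← (coords E k).finrank_eq]
  simp [two_mul]

theorem isometric_tensorQF_of_isHyperbolic_bc (h2 : (2 : F) ≠ 0)
    (hs : s * s = algebraMap F K a)
    (hE : ∀ x y, E (x, y) = algebraMap F K x + s * algebraMap F K y) (ha : a ≠ 0)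
    {q : Fin n → F} (hq : Anisotropic q) (h : IsHyperbolic (bc (algebraMap F K) q)) :
    ∃ (k : ℕ) (p : Fin k → F), Nondeg p ∧ Isometric q (tensorQF ![1, -a] p) := by
  obtain ⟨k, h⟩ := h
  have hdim : n = 2 * k := by rw [h.eq_dim, two_mul]
  obtain ⟨φ, hφ⟩ := h
  -- the totally isotropic subspace of dimension `k`, split into its two `F`-components
  let ψ : (Fin k → K) →ₗ[K] (Fin n → K) :=
    { toFun := fun z => φ.symm (Fin.append z z)
      map_add' := fun z w => by
        rw [← map_add]; congr 1; ext i; cases i using Fin.addCases <;>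
            simp [-Fin.natAdd_eq_addNat]
      map_smul' := fun c z => by
        rw [RingHom.id_apply, ← map_smul]; congr 1; ext i; cases i using Fin.addCases <;>
            simp [-Fin.natAdd_eq_addNat] }
  have hψ0 : ∀ z, ψ z = 0 → z = 0 := by
    intro z hz
    have hz' : Fin.append z z = 0 := φ.symm.map_eq_zero_iff.1 hz
    ext i
    simpa using congrFun hz' (Fin.castAdd k i)
  have hψ : ∀ z, evalQF (bc (algebraMap F K) q) (ψ z) = 0 := by
    intro z
    rw [← hφ]
    simp [ψ, evalQF, hypform, Fin.sum_univ_add, -Fin.natAdd_eq_addNat]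
  let C := coords (F := F) E n
  let P : (Fin k → K) →ₗ[F] (Fin n → F) :=
    LinearMap.fst F _ _ ∘ₗ C.symm.toLinearMap ∘ₗ ψ.restrictScalars F
  let Q : (Fin k → K) →ₗ[F] (Fin n → F) :=
    LinearMap.snd F _ _ ∘ₗ C.symm.toLinearMap ∘ₗ ψ.restrictScalars F
  have hPQ : ∀ z, C (P z, Q z) = ψ z := fun z => C.apply_symm_apply (ψ z)
  have hiso : ∀ z, evalQF q (P z) = -(a * evalQF q (Q z)) ∧ bilin q (P z) (Q z) = 0 := by
    intro z
    rw [← evalQF_coords_eq_zero_iff E h2 hs hE, ← hψ z, ← hPQ z]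
  have hPinj : Function.Injective P := by
    rw [injective_iff_map_eq_zero]
    intro z hz
    have h1 := (hiso z).1
    rw [hz] at h1
    have hQ : Q z = 0 := by
      by_contra hne
      exact mul_ne_zero ha (hq.evalQF_ne_zero hne) (by simpa [evalQF, eq_comm] using h1)
    apply hψ0
    rw [← hPQ, hz, hQ]
    exact map_zero C
  have hfin : Module.finrank F (Fin k → K) = Module.finrank F (Fin n → F) := by
    rw [finrank_pi_of_coords E, Module.finrank_fin_fun, hdim]
  have : Module.Finite F (Fin k → K) := Module.Finite.equiv (coords E k)
  let Pe : (Fin k → K) ≃ₗ[F] (Fin n → F) := LinearMap.linearEquivOfInjective P hPinj hfin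
  have hPe : ∀ x, P (Pe.symm x) = x := fun x => Pe.apply_symm_apply x
  have hsz : ∀ z, P (s • z) = a • Q z ∧ Q (s • z) = P z := by
    intro z
    have h1 : C (P (s • z), Q (s • z)) = C (a • Q z, P z) := by
      rw [hPQ, map_smul, ← hPQ, coords_apply E hE, coords_apply E hE]
      ext i
      simp only [Pi.add_apply, Pi.smul_apply, Function.comp_apply, smul_eq_mul, map_mul, ← hs]
      ring
    simpa using C.injective h1
  let T : (Fin n → F) →ₗ[F] (Fin n → F) := a • (Q ∘ₗ Pe.symm.toLinearMap)
  have hTdef : ∀ x, T x = a • Q (Pe.symm x) := fun x => rfl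
  have hT2 : ∀ x, T (T x) = a • x := by
    intro x
    have h1 : Pe.symm (T x) = s • Pe.symm x := by
      apply hPinj
      rw [hPe, (hsz _).1, hTdef]
    rw [hTdef (T x), h1, (hsz _).2, hPe]
  have hTself : ∀ x, bilin q x (T x) = 0 := by
    intro x
    have h1 := (hiso (Pe.symm x)).2
    rw [hPe] at h1
    rw [hTdef, map_smul, h1, smul_zero]
  have hT : ∀ x y, bilin q (T x) y = - bilin q x (T y) := by
    intro x y
    have h1 := hTself (x + y)
    simp only [map_add, LinearMap.add_apply, hTself, zero_add, add_zero] at h1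
    rw [bilin_comm q (T x) y]
    linear_combination h1
  exact ⟨k, isometric_tensorQF_of_sq_eq hq ha T hT2 hT hTself hdim.symm⟩

theorem isHyperbolic_bc_iff (h2 : (2 : F) ≠ 0) (hs : s * s = algebraMap F K a)
    (hE : ∀ x y, E (x, y) = algebraMap F K x + s * algebraMap F K y) (ha : a ≠ 0)
    {q : Fin n → F} (hq : Anisotropic q) :
    IsHyperbolic (bc (algebraMap F K) q) ↔
      ∃ (k : ℕ) (p : Fin k → F), Nondeg p ∧ Isometric q (tensorQF ![1, -a] p) := by
  refine ⟨isometric_tensorQF_of_isHyperbolic_bc E h2 hs hE ha hq, ?_⟩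
  rintro ⟨k, p, hp, h⟩
  have hs0 : s ≠ 0 := by
    rintro rfl
    exact ha (by simpa using hs.symm)
  have hr : ∀ r, (![1, -a] : Fin 2 → F) r ≠ 0 := by
    intro r
    fin_cases r <;> simp [ha]
  have hK := h.baseChange h2 (fun i => mul_ne_zero (hr _) (hp _)) (algebraMap F K)
  refine isHyperbolic_of_isometric_tensorQF (s := s) (p := bc (algebraMap F K) p)
    (fun h0 => h2 ((algebraMap F K).injective (by rw [map_ofNat, map_zero, h0]))) hs0 (fun i => by simpa [bc] using hp i) ?_
  convert hK using 1
  ext i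
  simp only [tensorQF, bc, map_mul, hs]
  congr 1
  generalize (finProdFinEquiv.symm i).1 = r
  fin_cases r <;> simp

theorem exists_coords_of_finrank_eq_two (hns : ¬ IsSquare a) (hs : s * s = algebraMap F K a)
    (hK : Module.finrank F K = 2) :
    ∃ E : (F × F) ≃ₗ[F] K, ∀ x y, E (x, y) = algebraMap F K x + s * algebraMap F K y := by
  let L : (F × F) →ₗ[F] K :=
    (Algebra.linearMap F K).coprod (LinearMap.mulLeft F s ∘ₗ Algebra.linearMap F K)
  have hL : ∀ x y, L (x, y) = algebraMap F K x + s * algebraMap F K y := fun x y => by simp [L]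
  have hinj : Function.Injective L := by
    rw [injective_iff_map_eq_zero]
    rintro ⟨x, y⟩ h
    rw [hL] at h
    have hy : y = 0 := by
      by_contra hy
      refine hns ⟨x / y, (algebraMap F K).injective ?_⟩
      have hy' : algebraMap F K y ≠ 0 := by simpa using hy
      rw [← hs, map_mul, map_div₀]
      field_simp
      linear_combination (s * algebraMap F K y - algebraMap F K x) * h
    subst hy
    simpa using h
  have : Module.Finite F K := Module.finite_of_finrank_pos (by omega)
  exact ⟨LinearMap.linearEquivOfInjective L hinj (by simp [hK]), fun x y => hL x y⟩

end QuadraticExtension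

open Polynomial in
theorem adjoinRoot_root_mul_self {R : Type*} [CommRing R] (a : R) :
    AdjoinRoot.root (X ^ 2 - C a) * AdjoinRoot.root (X ^ 2 - C a) =
      algebraMap R (AdjoinRoot (X ^ 2 - C a)) a := by
  have h := AdjoinRoot.eval₂_root (X ^ 2 - C a)
  rw [eval₂_sub, eval₂_pow, eval₂_X, eval₂_C, sub_eq_zero] at h
  rw [← sq]
  exact h

open Polynomial in
theorem finrank_adjoinRoot_sq_sub_C {F : Type*} [Field F] (a : F) :
    Module.finrank F (AdjoinRoot (X ^ 2 - C a)) = 2 := by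
  rw [(AdjoinRoot.powerBasis (X_pow_sub_C_ne_zero two_pos a)).finrank,
    AdjoinRoot.powerBasis_dim, natDegree_X_pow_sub_C]

end QF


open QF in
/-- Pfister's theorem on quadratic extensions `K = F(√a)` (`a ∈ F×` a non-square, char `F ≠ 2`),
for `q` anisotropic over `F`:
(i) `q_K` is isotropic iff `q ≅ b⟨1,-a⟩ ⊥ q'` for some `b ∈ F×` and some form `q'` over `F`;
(ii) `q_K` is hyperbolic iff `q ≅ ⟨1,-a⟩ ⊗ p` for some form `p` over `F`. -/
theorem stmt_2 {F : Type*} [Field F] (h2 : (2 : F) ≠ 0)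
    {nq : ℕ} (q : Fin nq → F) (hq : Nondeg q) (hq0 : 0 < nq) (hqan : Anisotropic q)
    (a : F) (ha : a ≠ 0) (hns : ¬ IsSquare a) :
    (Isotropic (bc (algebraMap F (AdjoinRoot (Polynomial.X ^ 2 - Polynomial.C a))) q)
      ↔ ∃ b : F, b ≠ 0 ∧ ∃ (k : ℕ) (q' : Fin k → F), Nondeg q' ∧
          Isometric q (osum (smulQF b ![1, -a]) q'))
    ∧
    (IsHyperbolic (bc (algebraMap F (AdjoinRoot (Polynomial.X ^ 2 - Polynomial.C a))) q)
      ↔ ∃ (k : ℕ) (p : Fin k → F), Nondeg p ∧ Isometric q (tensorQF ![1, -a] p)) := by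
  have : Fact (Irreducible (Polynomial.X ^ 2 - Polynomial.C a)) :=
    ⟨X_pow_sub_C_irreducible_of_prime Nat.prime_two
      fun b hb => hns ⟨b, by rw [← hb, sq]⟩⟩
  have hs := adjoinRoot_root_mul_self a
  obtain ⟨E, hE⟩ := exists_coords_of_finrank_eq_two hns hs (finrank_adjoinRoot_sq_sub_C a)
  exact ⟨isotropic_bc_iff E h2 hs hE ha hqan, isHyperbolic_bc_iff E h2 hs hE ha hqan⟩
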